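/- arXiv:0911.2904 — 4 statements merged into one kernel-verified Lean document; each statement's English description precedes it below -/
import Mathlib

section
/- Let U ⊆ ℝ^d be a convex set with nonempty interior, F : U → ℝ a Legendre potential (strictly convex and continuously differentiable on the interior of U, and essentially smooth), and S ⊆ int U a closed convex set. Let f : U → ℝ be convex, η > 0, and û ∈ S. Let g be a subgradient of f at û, let ũ ∈ int U satisfy ∇F(ũ) = ∇F(û) − η g, and let û⁺ = argmin_{u ∈ S} D_F(u, ũ) be the Bregman projection of ũ onto S. Then for every u ∈ S: f(û) ≤ f(u) + (1/η)·( D_F(u, û) − D_F(u, û⁺) + D_F(û, ũ) ). -/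
open scoped RealInnerProductSpace
open Filter

/-- The Bregman divergence `D_F(a, b) = F(a) − F(b) − ⟨∇F(b), a − b⟩` induced by a
potential `F` with gradient map `F'`. -/
noncomputable def bregmanDiv {d : ℕ}
    (F : EuclideanSpace ℝ (Fin d) → ℝ)
    (F' : EuclideanSpace ℝ (Fin d) → EuclideanSpace ℝ (Fin d))
    (a b : EuclideanSpace ℝ (Fin d)) : ℝ :=
  F a - F b - ⟪F' b, a - b⟫

/-- The three-point identity for Bregman divergences. -/
theorem bregmanDiv_three_point {d : ℕ}
    (F : EuclideanSpace ℝ (Fin d) → ℝ)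
    (F' : EuclideanSpace ℝ (Fin d) → EuclideanSpace ℝ (Fin d))
    (a b c : EuclideanSpace ℝ (Fin d)) :
    bregmanDiv F F' a c =
      bregmanDiv F F' a b + bregmanDiv F F' b c + ⟪F' b - F' c, a - b⟫ := by
  simp only [bregmanDiv, inner_sub_left, inner_sub_right]
  ring

/-- The Bregman divergence of a convex potential is nonnegative. -/
theorem bregmanDiv_nonneg {d : ℕ} {s : Set (EuclideanSpace ℝ (Fin d))}
    {F : EuclideanSpace ℝ (Fin d) → ℝ}
    {F' : EuclideanSpace ℝ (Fin d) → EuclideanSpace ℝ (Fin d)}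
    (hF : ConvexOn ℝ s F) {a b : EuclideanSpace ℝ (Fin d)} (ha : a ∈ s) (hb : b ∈ s)
    (hgrad : HasGradientAt F (F' b) b) :
    0 ≤ bregmanDiv F F' a b := by
  have hconv := hF.comp_affineMap (AffineMap.lineMap b a : ℝ →ᵃ[ℝ] EuclideanSpace ℝ (Fin d))
  have hline : HasDerivAt (AffineMap.lineMap b a : ℝ → EuclideanSpace ℝ (Fin d))
      (a - b) 0 := AffineMap.hasDerivAt_lineMap
  have hderiv : HasDerivAt (F ∘ (AffineMap.lineMap b a : ℝ → EuclideanSpace ℝ (Fin d)))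
      ⟪F' b, a - b⟫ 0 := by
    have hfd : HasFDerivAt F (InnerProductSpace.toDual ℝ _ (F' b))
        (AffineMap.lineMap b a (0 : ℝ)) := by
      simpa using hgrad.hasFDerivAt
    simpa using hfd.comp_hasDerivAt (0 : ℝ) hline
  have hslope := hconv.le_slope_of_hasDerivAt (x := 0) (y := 1)
    (by simpa using hb) (by simpa using ha) one_pos hderiv
  simp only [slope_def_field, Function.comp_apply, AffineMap.lineMap_apply_one,
    AffineMap.lineMap_apply_zero, sub_zero, div_one] at hslope
  unfold bregmanDiv
  linarith

/-- First-order optimality condition for the Bregman projection onto a convex set. -/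
theorem inner_nonneg_of_bregmanDiv_le {d : ℕ} {S : Set (EuclideanSpace ℝ (Fin d))}
    {F : EuclideanSpace ℝ (Fin d) → ℝ}
    {F' : EuclideanSpace ℝ (Fin d) → EuclideanSpace ℝ (Fin d)}
    (hS : Convex ℝ S) {p c u : EuclideanSpace ℝ (Fin d)} (hp : p ∈ S) (hu : u ∈ S)
    (hgrad : HasGradientAt F (F' p) p)
    (hproj : ∀ v ∈ S, bregmanDiv F F' p c ≤ bregmanDiv F F' v c) :
    0 ≤ ⟪F' p - F' c, u - p⟫ := by
  have hmin : IsMinOn (fun v => bregmanDiv F F' v c) S p := hproj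
  have hlin : HasFDerivAt (fun v : EuclideanSpace ℝ (Fin d) => ⟪F' c, v - c⟫)
      (InnerProductSpace.toDual ℝ _ (F' c)) p :=
    (InnerProductSpace.toDual ℝ _ (F' c)).hasFDerivAt.comp p
      ((hasFDerivAt_id p).sub_const c)
  have hfd := (hgrad.hasFDerivAt.sub_const (F c)).sub hlin
  have h := hmin.localize.hasFDerivWithinAt_nonneg hfd.hasFDerivWithinAt
    (sub_mem_posTangentConeAt_of_segment_subset (hS.segment_subset hp hu))
  simpa [inner_sub_left] using h

/-- **Lemma 1 (basic mirror descent regret bound).**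
`U ⊆ ℝ^d` convex with nonempty interior, `F` a Legendre potential (strictly convex and
continuously differentiable on `int U`, essentially smooth), `S ⊆ int U` closed convex,
`f` convex with subgradient `g` at `û ∈ S`, `ũ ∈ int U` with `∇F(ũ) = ∇F(û) − η g`, and
`û⁺` the Bregman projection of `ũ` onto `S`.  Then for every `u ∈ S`,
`f(û) ≤ f(u) + (1/η)(D_F(u, û) − D_F(u, û⁺) + D_F(û, ũ))`. -/
theorem mirror_descent_basic_bound
    {d : ℕ} {U S : Set (EuclideanSpace ℝ (Fin d))}
    (hUconv : Convex ℝ U) (hUint : (interior U).Nonempty)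
    {F : EuclideanSpace ℝ (Fin d) → ℝ}
    {F' : EuclideanSpace ℝ (Fin d) → EuclideanSpace ℝ (Fin d)}
    (hFstrict : StrictConvexOn ℝ (interior U) F)
    (hFgrad : ∀ u ∈ interior U, HasGradientAt F (F' u) u)
    (hFgradcont : ContinuousOn F' (interior U))
    (hFsteep : ∀ u : ℕ → EuclideanSpace ℝ (Fin d), (∀ n, u n ∈ interior U) →
      ∀ b ∈ frontier U, Tendsto u atTop (nhds b) →
        Tendsto (fun n => ‖F' (u n)‖) atTop atTop)
    (hSU : S ⊆ interior U) (hSclosed : IsClosed S) (hSconv : Convex ℝ S)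
    {f : EuclideanSpace ℝ (Fin d) → ℝ} (hf : ConvexOn ℝ U f)
    {η : ℝ} (hη : 0 < η)
    {uhat : EuclideanSpace ℝ (Fin d)} (huhat : uhat ∈ S)
    {g : EuclideanSpace ℝ (Fin d)}
    (hg : ∀ v ∈ U, f uhat + ⟪g, v - uhat⟫ ≤ f v)
    {util : EuclideanSpace ℝ (Fin d)} (hutil : util ∈ interior U)
    (hdual : F' util = F' uhat - η • g)
    {uplus : EuclideanSpace ℝ (Fin d)} (huplusS : uplus ∈ S)
    (hproj : ∀ u ∈ S, bregmanDiv F F' uplus util ≤ bregmanDiv F F' u util) :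
    ∀ u ∈ S,
      f uhat ≤ f u + (1 / η) *
        (bregmanDiv F F' u uhat - bregmanDiv F F' u uplus
          + bregmanDiv F F' uhat util) := by
  intro u hu
  have hopt := inner_nonneg_of_bregmanDiv_le hSconv huplusS hu
    (hFgrad uplus (hSU huplusS)) hproj
  have hnonneg := bregmanDiv_nonneg hFstrict.convexOn (hSU huplusS) hutil (hFgrad util hutil)
  have hplus := bregmanDiv_three_point F F' u uplus util
  have hhat := bregmanDiv_three_point F F' u uhat util
  have hsub := hg u (interior_subset (hSU hu))
  rw [hdual, sub_sub_cancel, real_inner_smul_left] at hhat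
  have hbound : -⟪g, u - uhat⟫ ≤ (1 / η) *
      (bregmanDiv F F' u uhat - bregmanDiv F F' u uplus + bregmanDiv F F' uhat util) := by
    rw [one_div_mul_eq_div, le_div_iff₀ hη]
    linarith
  linarith
end

section
/- Let ν be a σ-finite measure on a measurable space X, φ : X → ℝ^d measurable, Θ = { θ ∈ ℝ^d : ∫_X exp(⟨θ, φ(x)⟩) dν(x) < ∞ }, and Φ(θ) = log ∫_X exp(⟨θ, φ(x)⟩) dν(x). Then for every θ in the interior of Θ, Φ is differentiable at θ and its gradient equals the mean of the sufficient statistic: ∇Φ(θ) = ∫_X φ(x) exp(⟨θ, φ(x)⟩ − Φ(θ)) dν(x). -/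
open scoped RealInnerProductSpace
open MeasureTheory

open Filter Topology

/-- The Euclidean norm is attained up to a finite family of sign vectors. -/
lemma EuclideanSpace.exists_sign_norm_le_inner {d : ℕ} (v : EuclideanSpace ℝ (Fin d)) :
    ∃ s : Fin d → SignType, ‖v‖ ≤ ⟪WithLp.toLp 2 (fun i => ((s i : SignType) : ℝ)), v⟫ := by
  refine ⟨fun i => SignType.sign (v i), ?_⟩
  have h : ⟪WithLp.toLp 2 (fun i => ((SignType.sign (v i) : SignType) : ℝ)), v⟫ = ∑ i, |v i| := by
    simp [PiLp.inner_apply]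
  rw [h, EuclideanSpace.norm_eq]
  refine Real.sqrt_le_iff.mpr ⟨Finset.sum_nonneg fun i _ => abs_nonneg _, ?_⟩
  simpa only [Real.norm_eq_abs] using
    Finset.sum_sq_le_sq_sum_of_nonneg fun i _ => abs_nonneg (v i)

/-- At an interior point of the natural parameter space, some exponential moment of the norm of
the sufficient statistic is finite. -/
lemma exists_integrable_exp_inner_add_norm {d : ℕ} {X : Type*} [MeasurableSpace X]
    {ν : Measure X} {φ : X → EuclideanSpace ℝ (Fin d)} (hφ : Measurable φ)
    {θ : EuclideanSpace ℝ (Fin d)}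
    (hθ : ∀ᶠ η in 𝓝 θ, Integrable (fun x => Real.exp ⟪η, φ x⟫) ν) :
    ∃ δ > 0, Integrable (fun x => Real.exp (⟪θ, φ x⟫ + δ * ‖φ x‖)) ν := by
  let u : (Fin d → SignType) → EuclideanSpace ℝ (Fin d) :=
    fun s => WithLp.toLp 2 (fun i => ((s i : SignType) : ℝ))
  have h : ∀ᶠ δ in 𝓝[>] (0 : ℝ), ∀ s : Fin d → SignType,
      Integrable (fun x => Real.exp ⟪θ + δ • u s, φ x⟫) ν := by
    refine eventually_all.mpr fun s => ?_
    have hc : Tendsto (fun δ : ℝ => θ + δ • u s) (𝓝 0) (𝓝 θ) := by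
      have : Continuous fun δ : ℝ => θ + δ • u s := by fun_prop
      simpa using this.tendsto 0
    exact (hc.mono_left nhdsWithin_le_nhds).eventually hθ
  obtain ⟨δ, hδ, hpos⟩ := (h.and self_mem_nhdsWithin).exists
  have hpos : 0 < δ := hpos
  refine ⟨δ, hpos, (integrable_finsetSum Finset.univ fun s _ => hδ s).mono'
    (by fun_prop) (ae_of_all _ fun x => ?_)⟩
  obtain ⟨s, hs⟩ := EuclideanSpace.exists_sign_norm_le_inner (φ x)
  rw [Real.norm_of_nonneg (Real.exp_nonneg _)]
  calc Real.exp (⟪θ, φ x⟫ + δ * ‖φ x‖) ≤ Real.exp ⟪θ + δ • u s, φ x⟫ := by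
        rw [inner_add_left, real_inner_smul_left]
        gcongr
    _ ≤ ∑ s, Real.exp ⟪θ + δ • u s, φ x⟫ :=
        Finset.single_le_sum (f := fun s => Real.exp ⟪θ + δ • u s, φ x⟫)
          (fun _ _ => Real.exp_nonneg _) (Finset.mem_univ s)

/-- The Laplace transform of the sufficient statistic may be differentiated under the integral
at interior points of its domain. -/
lemma hasGradientAt_integral_exp_inner {d : ℕ} {X : Type*} [MeasurableSpace X]
    {ν : Measure X} {φ : X → EuclideanSpace ℝ (Fin d)} (hφ : Measurable φ)
    {θ : EuclideanSpace ℝ (Fin d)}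
    (hθ : ∀ᶠ η in 𝓝 θ, Integrable (fun x => Real.exp ⟪η, φ x⟫) ν) :
    HasGradientAt (fun η => ∫ x, Real.exp ⟪η, φ x⟫ ∂ν)
      (∫ x, Real.exp ⟪θ, φ x⟫ • φ x ∂ν) θ := by
  obtain ⟨δ, hδ, hint⟩ := exists_integrable_exp_inner_add_norm hφ hθ
  have key := hasFDerivAt_integral_of_dominated_of_fderiv_le (𝕜 := ℝ) (μ := ν)
    (F := fun η x => Real.exp ⟪η, φ x⟫)
    (F' := fun η x => InnerProductSpace.toDual ℝ _ (Real.exp ⟪η, φ x⟫ • φ x))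
    (bound := fun x => (δ / 2)⁻¹ * Real.exp (⟪θ, φ x⟫ + δ * ‖φ x‖))
    (Metric.ball_mem_nhds θ (half_pos hδ)) (.of_forall fun η => by fun_prop) hθ.self_of_nhds
    ((LinearIsometryEquiv.continuous _).comp_aestronglyMeasurable (by fun_prop))
    (ae_of_all _ fun x η hη => ?_) (hint.const_mul _) (ae_of_all _ fun x η _ => ?_)
  · rw [hasGradientAt_iff_hasFDerivAt]
    let L : EuclideanSpace ℝ (Fin d) ≃L[ℝ] StrongDual ℝ (EuclideanSpace ℝ (Fin d)) :=
      (InnerProductSpace.toDual ℝ _).toContinuousLinearEquiv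
    exact (L.integral_comp_comm (μ := ν) fun x => Real.exp ⟪θ, φ x⟫ • φ x) ▸ key
  · rw [LinearIsometryEquiv.norm_map, norm_smul, Real.norm_of_nonneg (Real.exp_nonneg _)]
    have h₁ : ⟪η, φ x⟫ ≤ ⟪θ, φ x⟫ + δ / 2 * ‖φ x‖ := by
      have h := real_inner_le_norm (η - θ) (φ x)
      rw [inner_sub_left] at h
      have h' : ‖η - θ‖ * ‖φ x‖ ≤ δ / 2 * ‖φ x‖ := by
        gcongr
        exact (mem_ball_iff_norm.mp hη).le
      linarith
    have h₂ : ‖φ x‖ ≤ (δ / 2)⁻¹ * Real.exp (δ / 2 * ‖φ x‖) := by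
      rw [inv_mul_eq_div, le_div_iff₀' (half_pos hδ)]
      linarith [Real.add_one_le_exp (δ / 2 * ‖φ x‖)]
    calc Real.exp ⟪η, φ x⟫ * ‖φ x‖
        ≤ Real.exp (⟪θ, φ x⟫ + δ / 2 * ‖φ x‖) * ((δ / 2)⁻¹ * Real.exp (δ / 2 * ‖φ x‖)) := by
          gcongr
      _ = (δ / 2)⁻¹ * Real.exp (⟪θ, φ x⟫ + δ * ‖φ x‖) := by
          rw [mul_left_comm, ← Real.exp_add]
          ring_nf
  · have h : HasFDerivAt (fun η => ⟪η, φ x⟫) (InnerProductSpace.toDual ℝ _ (φ x)) η := by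
      refine (InnerProductSpace.toDual ℝ _ (φ x)).hasFDerivAt.congr_of_eventuallyEq
        (.of_forall fun y => ?_)
      simp [real_inner_comm]
    simpa using h.exp

/-- **Differentiability of the log partition function on the interior of the natural
parameter space, with gradient equal to the mean of the sufficient statistic.**
For `Θ = {θ : ∫ exp⟨θ, φ(x)⟩ dν < ∞}` and `Φ(θ) = log ∫ exp⟨θ, φ(x)⟩ dν`, for every
`θ ∈ int Θ` one has `∇Φ(θ) = ∫ φ(x) exp(⟨θ, φ(x)⟩ − Φ(θ)) dν`. -/
theorem gradient_log_partition
    {d : ℕ} {X : Type*} [MeasurableSpace X] (ν : Measure X) [SigmaFinite ν]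
    (φ : X → EuclideanSpace ℝ (Fin d)) (hφ : Measurable φ)
    (Θ : Set (EuclideanSpace ℝ (Fin d)))
    (hΘ : Θ = {θ | Integrable (fun x => Real.exp ⟪θ, φ x⟫) ν})
    (Φ : EuclideanSpace ℝ (Fin d) → ℝ)
    (hΦ : ∀ θ, Φ θ = Real.log (∫ x, Real.exp ⟪θ, φ x⟫ ∂ν)) :
    ∀ θ ∈ interior Θ,
      HasGradientAt Φ (∫ x, Real.exp (⟪θ, φ x⟫ - Φ θ) • φ x ∂ν) θ := by
  intro θ hθ
  have hev : ∀ᶠ η in 𝓝 θ, Integrable (fun x => Real.exp ⟪η, φ x⟫) ν := by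
    rw [mem_interior_iff_mem_nhds, hΘ] at hθ
    exact hθ
  obtain rfl : Φ = fun η => Real.log (∫ x, Real.exp ⟪η, φ x⟫ ∂ν) := funext hΦ
  rcases eq_zero_or_neZero ν with rfl | hν
  · simpa using hasGradientAt_const θ (0 : ℝ)
  have hpos : 0 < ∫ x, Real.exp ⟪θ, φ x⟫ ∂ν := integral_exp_pos hev.self_of_nhds
  have h := (hasGradientAt_integral_exp_inner hφ hev).hasFDerivAt.log hpos.ne'
  rw [hasGradientAt_iff_hasFDerivAt]
  have hmean : ∫ x, Real.exp (⟪θ, φ x⟫ - Real.log (∫ y, Real.exp ⟪θ, φ y⟫ ∂ν)) • φ x ∂ν =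
      (∫ y, Real.exp ⟪θ, φ y⟫ ∂ν)⁻¹ • ∫ x, Real.exp ⟪θ, φ x⟫ • φ x ∂ν := by
    simp_rw [Real.exp_sub, Real.exp_log hpos, div_eq_inv_mul, mul_smul, integral_smul]
  rw [hmean, map_smulₛₗ]
  exact h
end

section
/- (Theorem 1, logarithmic regret against static strategies.) Let Θ ⊆ ℝ^d be open convex, Φ : Θ → ℝ strictly convex, twice continuously differentiable with ∇²Φ(θ) ⪰ 2H·I for all θ ∈ Θ for some H > 0, and let Λ ⊆ Θ be closed and convex with M = (1/2)·sup_{θ∈Λ} ‖∇Φ(θ)‖ < ∞. Fix T ≥ 1, arbitrary points z_1,…,z_T in a set Z, and h : Z → ℝ^d, and let K = (1/2)·max_{1≤t≤T} ‖h(z_t)‖. Let θ̂_1 ∈ Λ and, for t ≥ 1 with step size η_t = 1/t, let θ̃_{t+1} ∈ Θ satisfy ∇Φ(θ̃_{t+1}) = ∇Φ(θ̂_t) − η_t (∇Φ(θ̂_t) − h(z_t)) and θ̂_{t+1} = argmin_{θ∈Λ} D(θ̃_{t+1} ‖ θ). Then for every θ ∈ Λ: ∑_{t=1}^T ℓ̂(θ̂_t,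 z_t) ≤ ∑_{t=1}^T ℓ̂(θ, z_t) + D(θ̂_1 ‖ θ) + ((K + M)²/H)·(log T + 1). -/
open scoped RealInnerProductSpace

/-- Bregman (Kullback–Leibler) divergence `D(θ₁‖θ₂) = Φ(θ₂) − Φ(θ₁) − ⟨∇Φ(θ₁), θ₂ − θ₁⟩`
induced by a potential `Φ` with gradient map `Φ'`. -/
noncomputable def klDiv {d : ℕ}
    (Φ : EuclideanSpace ℝ (Fin d) → ℝ)
    (Φ' : EuclideanSpace ℝ (Fin d) → EuclideanSpace ℝ (Fin d))
    (θ₁ θ₂ : EuclideanSpace ℝ (Fin d)) : ℝ :=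
  Φ θ₂ - Φ θ₁ - ⟪Φ' θ₁, θ₂ - θ₁⟫

/-- The filtering loss `ℓ̂(θ, z) = −⟨θ, h(z)⟩ + Φ(θ)`. -/
noncomputable def filterLoss {d : ℕ} {Z : Type*}
    (Φ : EuclideanSpace ℝ (Fin d) → ℝ)
    (h : Z → EuclideanSpace ℝ (Fin d))
    (θ : EuclideanSpace ℝ (Fin d)) (z : Z) : ℝ :=
  -⟪θ, h z⟫ + Φ θ

/-- The identity relating three Bregman divergences. -/
theorem klDiv_three_point {d : ℕ} (Φ : EuclideanSpace ℝ (Fin d) → ℝ)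
    (Φ' : EuclideanSpace ℝ (Fin d) → EuclideanSpace ℝ (Fin d))
    (a b c : EuclideanSpace ℝ (Fin d)) :
    ⟪Φ' a - Φ' c, a - b⟫ = klDiv Φ Φ' a b - klDiv Φ Φ' c b + klDiv Φ Φ' c a := by
  simp only [klDiv, inner_sub_left, inner_sub_right]
  ring

/-- A lower bound on the Hessian makes the Bregman divergence dominate the squared distance. -/
theorem mul_norm_sq_le_klDiv {d : ℕ} {Θ : Set (EuclideanSpace ℝ (Fin d))} (hΘ : Convex ℝ Θ)
    {Φ : EuclideanSpace ℝ (Fin d) → ℝ}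
    {Φ' : EuclideanSpace ℝ (Fin d) → EuclideanSpace ℝ (Fin d)}
    {Φ'' : EuclideanSpace ℝ (Fin d) →
      (EuclideanSpace ℝ (Fin d) →L[ℝ] EuclideanSpace ℝ (Fin d))}
    (hgrad : ∀ θ ∈ Θ, HasGradientAt Φ (Φ' θ) θ)
    (hhess : ∀ θ ∈ Θ, HasFDerivAt Φ' (Φ'' θ) θ) {H : ℝ}
    (hlb : ∀ θ ∈ Θ, ∀ v : EuclideanSpace ℝ (Fin d), 2 * H * ‖v‖ ^ 2 ≤ ⟪v, Φ'' θ v⟫)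
    {a b : EuclideanSpace ℝ (Fin d)} (ha : a ∈ Θ) (hb : b ∈ Θ) :
    H * ‖b - a‖ ^ 2 ≤ klDiv Φ Φ' a b := by
  set v := b - a with hv
  have hmem : ∀ s ∈ Set.Icc (0 : ℝ) 1, a + s • v ∈ Θ := fun s hs =>
    hΘ.add_smul_sub_mem ha hb hs
  have hline : ∀ s : ℝ, HasDerivAt (fun s : ℝ => a + s • v) v s := fun s => by
    simpa using ((hasDerivAt_id s).smul_const v).const_add a
  have hslope : ∀ s ∈ Set.Icc (0 : ℝ) 1, HasDerivAt
      (fun s : ℝ => ⟪v, Φ' (a + s • v)⟫ - 2 * H * ‖v‖ ^ 2 * s)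
      (⟪v, Φ'' (a + s • v) v⟫ - 2 * H * ‖v‖ ^ 2) s := fun s hs => by
    have h₁ := (hhess _ (hmem s hs)).comp_hasDerivAt s (hline s)
    have h₂ := (innerSL ℝ v).hasFDerivAt.comp_hasDerivAt s h₁
    exact (h₂.sub ((hasDerivAt_id s).const_mul (2 * H * ‖v‖ ^ 2))).congr_deriv (by simp)
  have hvalue : ∀ s ∈ Set.Icc (0 : ℝ) 1, HasDerivAt
      (fun s : ℝ => Φ (a + s • v) - ⟪v, Φ' a⟫ * s - H * ‖v‖ ^ 2 * s ^ 2)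
      (⟪v, Φ' (a + s • v)⟫ - ⟪v, Φ' a⟫ - H * ‖v‖ ^ 2 * (2 * s)) s := fun s hs => by
    have h₁ := (hgrad _ (hmem s hs)).hasFDerivAt.comp_hasDerivAt s (hline s)
    have h₂ := (h₁.sub ((hasDerivAt_id s).const_mul ⟪v, Φ' a⟫)).sub
      (((hasDerivAt_id s).pow 2).const_mul (H * ‖v‖ ^ 2))
    exact h₂.congr_deriv (by simp [real_inner_comm])
  have hslope_mono : MonotoneOn
      (fun s : ℝ => ⟪v, Φ' (a + s • v)⟫ - 2 * H * ‖v‖ ^ 2 * s) (Set.Icc 0 1) :=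
    monotoneOn_of_hasDerivWithinAt_nonneg (convex_Icc 0 1)
      (fun s hs => (hslope s hs).continuousAt.continuousWithinAt)
      (fun s hs => (hslope s (interior_subset hs)).hasDerivWithinAt)
      (fun s hs => sub_nonneg.2 (hlb _ (hmem s (interior_subset hs)) v))
  have hvalue_mono : MonotoneOn
      (fun s : ℝ => Φ (a + s • v) - ⟪v, Φ' a⟫ * s - H * ‖v‖ ^ 2 * s ^ 2) (Set.Icc 0 1) :=
    monotoneOn_of_hasDerivWithinAt_nonneg (convex_Icc 0 1)
      (fun s hs => (hvalue s hs).continuousAt.continuousWithinAt)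
      (fun s hs => (hvalue s (interior_subset hs)).hasDerivWithinAt)
      (fun s hs => by
        have hs' := interior_subset hs
        have := hslope_mono (Set.left_mem_Icc.2 zero_le_one) hs' hs'.1
        simp only [zero_smul, add_zero] at this
        linarith)
  have key := hvalue_mono (Set.left_mem_Icc.2 zero_le_one) (Set.right_mem_Icc.2 zero_le_one)
    zero_le_one
  have hab : a + v = b := by simp [hv]
  simp only [zero_smul, add_zero, one_smul, hab] at key
  rw [klDiv, ← hv, real_inner_comm]
  linarith

/-- The generalized Pythagorean inequality for the Bregman projection `b` of `c` onto a
convex set. -/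
theorem klDiv_proj_add_le {d : ℕ} {Λ : Set (EuclideanSpace ℝ (Fin d))} (hΛ : Convex ℝ Λ)
    {Φ : EuclideanSpace ℝ (Fin d) → ℝ}
    {Φ' : EuclideanSpace ℝ (Fin d) → EuclideanSpace ℝ (Fin d)}
    {b c θ : EuclideanSpace ℝ (Fin d)} (hgrad : HasGradientAt Φ (Φ' b) b)
    (hb : b ∈ Λ) (hmin : ∀ x ∈ Λ, klDiv Φ Φ' c b ≤ klDiv Φ Φ' c x) (hθ : θ ∈ Λ) :
    klDiv Φ Φ' c b + klDiv Φ Φ' b θ ≤ klDiv Φ Φ' c θ := by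
  have hderiv : HasFDerivAt (klDiv Φ Φ' c) (innerSL ℝ (Φ' b) - innerSL ℝ (Φ' c)) b := by
    have h₁ := (innerSL ℝ (Φ' c)).hasFDerivAt.comp b ((hasFDerivAt_id (𝕜 := ℝ) b).sub_const c)
    exact (hgrad.hasFDerivAt.sub_const (Φ c)).sub h₁
  have hlocal : IsLocalMinOn (klDiv Φ Φ' c) Λ b := (isMinOn_iff.2 hmin).localize
  have hnonneg := hlocal.hasFDerivWithinAt_nonneg hderiv.hasFDerivWithinAt
    (sub_mem_posTangentConeAt_of_segment_subset (hΛ.segment_subset hb hθ))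
  simp only [sub_apply, innerSL_apply_apply, inner_sub_right] at hnonneg
  simp only [klDiv, inner_sub_right]
  linarith

/-- Quadratic growth of the Bregman divergence bounds it by the squared distance between the dual
points `Φ' a` and `Φ' c`. -/
theorem klDiv_le_norm_sq_div {d : ℕ} {Φ : EuclideanSpace ℝ (Fin d) → ℝ}
    {Φ' : EuclideanSpace ℝ (Fin d) → EuclideanSpace ℝ (Fin d)}
    {a c : EuclideanSpace ℝ (Fin d)} {H : ℝ} (hH : 0 < H)
    (hac : H * ‖c - a‖ ^ 2 ≤ klDiv Φ Φ' a c) :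
    klDiv Φ Φ' c a ≤ ‖Φ' a - Φ' c‖ ^ 2 / (4 * H) := by
  have hsymm : klDiv Φ Φ' a c + klDiv Φ Φ' c a = ⟪Φ' a - Φ' c, a - c⟫ := by
    simp only [klDiv, inner_sub_left, inner_sub_right]
    ring
  have hcs := real_inner_le_norm (Φ' a - Φ' c) (a - c)
  rw [norm_sub_rev a c] at hcs
  rw [le_div_iff₀ (by positivity)]
  nlinarith [sq_nonneg (‖Φ' a - Φ' c‖ - 2 * H * ‖c - a‖)]

/-- **Theorem 1 (logarithmic regret against static strategies).** -/
theorem log_regret_static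
    {d : ℕ} {Θ Λ : Set (EuclideanSpace ℝ (Fin d))}
    (hΘopen : IsOpen Θ) (hΘconv : Convex ℝ Θ)
    {Φ : EuclideanSpace ℝ (Fin d) → ℝ}
    {Φ' : EuclideanSpace ℝ (Fin d) → EuclideanSpace ℝ (Fin d)}
    {Φ'' : EuclideanSpace ℝ (Fin d) →
      (EuclideanSpace ℝ (Fin d) →L[ℝ] EuclideanSpace ℝ (Fin d))}
    (hstrict : StrictConvexOn ℝ Θ Φ)
    (hgrad : ∀ θ ∈ Θ, HasGradientAt Φ (Φ' θ) θ)
    (hhess : ∀ θ ∈ Θ, HasFDerivAt Φ' (Φ'' θ) θ)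
    (hhesscont : ContinuousOn Φ'' Θ)
    {H : ℝ} (hH : 0 < H)
    (hlb : ∀ θ ∈ Θ, ∀ v : EuclideanSpace ℝ (Fin d), 2 * H * ‖v‖ ^ 2 ≤ ⟪v, Φ'' θ v⟫)
    (hΛΘ : Λ ⊆ Θ) (hΛclosed : IsClosed Λ) (hΛconv : Convex ℝ Λ)
    {M : ℝ} (hM : IsLUB ((fun θ => (1 / 2 : ℝ) * ‖Φ' θ‖) '' Λ) M)
    {T : ℕ} (hT : 1 ≤ T)
    {Z : Type*} (z : ℕ → Z) (h : Z → EuclideanSpace ℝ (Fin d))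
    {K : ℝ} (hK : IsGreatest ((fun t => (1 / 2 : ℝ) * ‖h (z t)‖) '' Set.Icc 1 T) K)
    (θhat θtil : ℕ → EuclideanSpace ℝ (Fin d))
    (hinit : θhat 1 ∈ Λ)
    (hdualmem : ∀ t, 1 ≤ t → θtil (t + 1) ∈ Θ)
    (hdual : ∀ t, 1 ≤ t →
      Φ' (θtil (t + 1))
        = Φ' (θhat t) - (1 / (t : ℝ)) • (Φ' (θhat t) - h (z t)))
    (hprojmem : ∀ t, 1 ≤ t → θhat (t + 1) ∈ Λ)
    (hproj : ∀ t, 1 ≤ t → ∀ θ ∈ Λ,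
      klDiv Φ Φ' (θtil (t + 1)) (θhat (t + 1)) ≤ klDiv Φ Φ' (θtil (t + 1)) θ) :
    ∀ θ ∈ Λ,
      ∑ t ∈ Finset.Icc 1 T, filterLoss Φ h (θhat t) (z t)
        ≤ ∑ t ∈ Finset.Icc 1 T, filterLoss Φ h θ (z t)
          + klDiv Φ Φ' (θhat 1) θ
          + ((K + M) ^ 2 / H) * (Real.log T + 1) := by
  intro θ hθ
  have hKM : ∀ t ∈ Finset.Icc 1 T, θhat t ∈ Λ → ‖Φ' (θhat t) - h (z t)‖ ≤ 2 * (K + M) := by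
    intro t ht hmem
    have h₁ := hM.1 (Set.mem_image_of_mem _ hmem)
    have h₂ := hK.2 (Set.mem_image_of_mem _ (Finset.mem_Icc.1 ht))
    have h₃ := norm_sub_le (Φ' (θhat t)) (h (z t))
    linarith
  have hhat : ∀ t, 1 ≤ t → θhat t ∈ Λ := by
    intro t ht
    obtain rfl | ht := ht.eq_or_lt
    · exact hinit
    · obtain ⟨s, rfl⟩ := Nat.exists_eq_add_of_lt ht
      exact hprojmem (1 + s) (by omega)
  have hstep : ∀ t ∈ Finset.Icc 1 T, filterLoss Φ h (θhat t) (z t) - filterLoss Φ h θ (z t)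
      ≤ ((t : ℝ) - 1) * klDiv Φ Φ' (θhat t) θ - t * klDiv Φ Φ' (θhat (t + 1)) θ
        + (K + M) ^ 2 / H * (t : ℝ)⁻¹ := by
    intro t ht
    have ht₁ : 1 ≤ t := (Finset.mem_Icc.1 ht).1
    have ht₀ : (0 : ℝ) < t := by exact_mod_cast ht₁
    have hmem := hhat t ht₁
    have hnext := hΛΘ (hprojmem t ht₁)
    have htil := hdualmem t ht₁
    set g := Φ' (θhat t) - h (z t) with hg
    have hloss : filterLoss Φ h (θhat t) (z t) - filterLoss Φ h θ (z t)
        = ⟪g, θhat t - θ⟫ - klDiv Φ Φ' (θhat t) θ := by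
      simp only [filterLoss, klDiv, hg, inner_sub_left, inner_sub_right,
        real_inner_comm (h (z t))]
      ring
    have hdiff : Φ' (θhat t) - Φ' (θtil (t + 1)) = (1 / (t : ℝ)) • g := by
      rw [hdual t ht₁, sub_sub_cancel]
    have hthree := klDiv_three_point Φ Φ' (θhat t) θ (θtil (t + 1))
    rw [hdiff, real_inner_smul_left] at hthree
    have hpyth := klDiv_proj_add_le hΛconv (hgrad _ hnext) (hprojmem t ht₁) (hproj t ht₁) hθ
    have hpos := mul_norm_sq_le_klDiv hΘconv hgrad hhess hlb htil hnext
    have hpos' : 0 ≤ klDiv Φ Φ' (θtil (t + 1)) (θhat (t + 1)) := le_trans (by positivity) hpos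
    have hquad := klDiv_le_norm_sq_div hH
      (mul_norm_sq_le_klDiv hΘconv hgrad hhess hlb (hΛΘ hmem) htil)
    rw [hdiff, norm_smul, Real.norm_of_nonneg (by positivity)] at hquad
    have hgnorm : ‖g‖ ^ 2 ≤ (2 * (K + M)) ^ 2 := by
      gcongr
      exact hKM t ht hmem
    have hquad' : t * klDiv Φ Φ' (θtil (t + 1)) (θhat t) ≤ (K + M) ^ 2 / H * (t : ℝ)⁻¹ := by
      calc t * klDiv Φ Φ' (θtil (t + 1)) (θhat t)
          ≤ t * ((1 / (t : ℝ) * ‖g‖) ^ 2 / (4 * H)) := by gcongr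
        _ = ‖g‖ ^ 2 / (4 * H) * (t : ℝ)⁻¹ := by field_simp
        _ ≤ (2 * (K + M)) ^ 2 / (4 * H) * (t : ℝ)⁻¹ := by gcongr
        _ = (K + M) ^ 2 / H * (t : ℝ)⁻¹ := by field_simp; ring
    have hinner : ⟪g, θhat t - θ⟫ = t * (klDiv Φ Φ' (θhat t) θ
        - klDiv Φ Φ' (θtil (t + 1)) θ + klDiv Φ Φ' (θtil (t + 1)) (θhat t)) := by
      rw [← hthree]
      field_simp
    have hdecr : t * klDiv Φ Φ' (θhat (t + 1)) θ ≤ t * klDiv Φ Φ' (θtil (t + 1)) θ := by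
      gcongr
      linarith
    rw [hloss, hinner]
    linarith
  have htele : ∀ n : ℕ, ∑ t ∈ Finset.Icc 1 n, (((t : ℝ) - 1) * klDiv Φ Φ' (θhat t) θ
      - t * klDiv Φ Φ' (θhat (t + 1)) θ) = -(n * klDiv Φ Φ' (θhat (n + 1)) θ) := by
    intro n
    induction n with
    | zero => simp
    | succ n ih =>
      rw [Finset.sum_Icc_succ_top (by omega), ih]
      push_cast
      ring
  have hharm : ∑ t ∈ Finset.Icc 1 T, ((t : ℝ))⁻¹ ≤ 1 + Real.log T := by
    have := harmonic_le_one_add_log T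
    rw [harmonic_eq_sum_Icc] at this
    push_cast at this
    exact this
  have hnonneg : ∀ x ∈ Λ, 0 ≤ klDiv Φ Φ' x θ := fun x hx =>
    le_trans (by positivity)
      (mul_norm_sq_le_klDiv hΘconv hgrad hhess hlb (hΛΘ hx) (hΛΘ hθ))
  have hsum := Finset.sum_le_sum hstep
  rw [Finset.sum_sub_distrib, Finset.sum_add_distrib, htele, ← Finset.mul_sum] at hsum
  have hlast : 0 ≤ (T : ℝ) * klDiv Φ Φ' (θhat (T + 1)) θ :=
    mul_nonneg (Nat.cast_nonneg T) (hnonneg _ (hprojmem T hT))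
  have hlog := mul_le_mul_of_nonneg_left hharm (show 0 ≤ (K + M) ^ 2 / H by positivity)
  have hfirst := hnonneg _ hinit
  linarith
end

section
/- (Per-step hedging inequality.) Fix reals τ_min < τ_max, η > 0, ζ ∈ ℝ, y ∈ {−1,+1}, and τ_t ∈ [τ_min, τ_max]. Let ŷ = sgn(τ_t − ζ), τ̃ = τ_t + η·y·1{ŷ ≠ y}, and τ⁺ = Π(τ̃). Then for every τ ∈ [τ_min, τ_max]: η·(1 − max(0, 1 − (τ − ζ)·y))·1{ŷ ≠ y} ≤ (1/2)·( (τ − τ_t)² − (τ − τ⁺)² + (τ_t − τ̃)² ). -/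
/-- sign function: `-1` if `a ≤ 0`, `+1` if `a > 0`. -/
noncomputable def sgn (a : ℝ) : ℝ := if a ≤ 0 then -1 else 1

/-- Projection of `ℝ` onto the interval `[τmin, τmax]`. -/
noncomputable def projInt (τmin τmax α : ℝ) : ℝ := max τmin (min τmax α)

/-- Projecting onto an interval does not increase the distance to points of that interval. -/
theorem sq_sub_projInt_le {a b x : ℝ} (hx : x ∈ Set.Icc a b) (α : ℝ) :
    (x - projInt a b α) ^ 2 ≤ (x - α) ^ 2 := by
  obtain ⟨hax, hxb⟩ := hx
  unfold projInt
  rcases le_total b α with h | h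
  · rw [min_eq_left h, max_eq_right (hax.trans hxb)]
    nlinarith
  · rw [min_eq_right h]
    rcases le_total a α with h' | h'
    · rw [max_eq_right h']
    · rw [max_eq_left h']
      nlinarith

/-- A sign prediction that misses the label has nonpositive margin. -/
theorem mul_nonpos_of_sgn_ne {a y : ℝ} (hy : y = 1 ∨ y = -1) (h : sgn a ≠ y) :
    a * y ≤ 0 := by
  unfold sgn at h
  rcases hy with rfl | rfl <;> split_ifs at h <;> first | exact absurd rfl h | linarith

/-- **Per-step hedging inequality.** -/
theorem per_step_hedging
    (τmin τmax : ℝ) (hττ : τmin < τmax)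
    (η : ℝ) (hη : 0 < η) (ζ : ℝ) (y : ℝ) (hy : y = 1 ∨ y = -1)
    (τt : ℝ) (hτt : τt ∈ Set.Icc τmin τmax)
    (yhat : ℝ) (hyhat : yhat = sgn (τt - ζ))
    (τtil : ℝ) (hτtil : τtil = τt + η * y * (if yhat ≠ y then 1 else 0))
    (τplus : ℝ) (hτplus : τplus = projInt τmin τmax τtil) :
    ∀ τ ∈ Set.Icc τmin τmax,
      η * (1 - max 0 (1 - (τ - ζ) * y)) * (if yhat ≠ y then 1 else 0)
        ≤ (1 / 2) * ((τ - τt) ^ 2 - (τ - τplus) ^ 2 + (τt - τtil) ^ 2) := by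
  intro τ hτ
  have hproj := sq_sub_projInt_le hτ τtil
  rw [← hτplus] at hproj
  by_cases h : yhat ≠ y
  · rw [if_pos h] at hτtil ⊢
    have hmargin := mul_nonpos_of_sgn_ne hy (hyhat ▸ h)
    have hhinge := le_max_right 0 (1 - (τ - ζ) * y)
    have hgain : 1 - max 0 (1 - (τ - ζ) * y) ≤ (τ - τt) * y := by linarith
    have hscaled := mul_le_mul_of_nonneg_left hgain hη.le
    have hsq : (τ - τt) ^ 2 - (τ - τtil) ^ 2 + (τt - τtil) ^ 2
        = 2 * (η * ((τ - τt) * y)) := by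
      rw [hτtil]
      ring
    linarith
  · rw [if_neg h] at hτtil ⊢
    rw [mul_zero, add_zero] at hτtil
    rw [hτtil] at hproj ⊢
    linarith [sq_nonneg (τt - τt)]
end
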